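/- For all indices i, j ∈ {0, …, m} and all kG-modules M and N, the k-linear map ⊕_{t=0}^m Hom_{kG}(L_t, L_j ⊗ M) ⊗_k Hom_{kG}(L_i, L_t ⊗ N) → Hom_{kG}(L_i, L_j ⊗ M ⊗ N) sending f ⊗ g to (f ⊗ id_N) ∘ g is an isomorphism of k-vector spaces. (This is the componentwise form of the monoidality of the functor F = Hom_{kG}(L, L ⊗ −).) -/

import Mathlib

open CategoryTheory MonoidalCategory DirectSum

universe u

noncomputable section

section LinearAlgebra

variable {k V U : Type*} [Field k] [AddCommGroup V] [Module k V] [AddCommGroup U] [Module k U]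

theorem TensorProduct.eq_zero_of_forall_lTensor_dual_eq_zero (z : TensorProduct k V U)
    (h : ∀ ψ : U →ₗ[k] k, TensorProduct.rid k V (ψ.lTensor V z) = 0) : z = 0 := by
  classical
  let b := Module.Basis.ofVectorSpace k U
  apply (TensorProduct.equivFinsuppOfBasisRight b (M := V)).injective
  rw [map_zero]
  ext i
  rw [TensorProduct.equivFinsuppOfBasisRight_apply]
  exact h (b.coord i)

/-- A tensor is zero if it is killed by a point-separating family of functionals on the
left factor. -/
theorem TensorProduct.eq_zero_of_separating {ι : Type*} (φ : ι → V →ₗ[k] k)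
    (hφ : ∀ v, (∀ r, φ r v = 0) → v = 0) (z : TensorProduct k V U)
    (h : ∀ r, TensorProduct.lid k U ((φ r).rTensor U z) = 0) : z = 0 := by
  refine TensorProduct.eq_zero_of_forall_lTensor_dual_eq_zero z fun ψ ↦ hφ _ fun r ↦ ?_
  have key : φ r ∘ₗ (TensorProduct.rid k V).toLinearMap ∘ₗ ψ.lTensor V =
      ψ ∘ₗ (TensorProduct.lid k U).toLinearMap ∘ₗ (φ r).rTensor U := by
    ext v u
    simp [mul_comm]
  have := LinearMap.congr_fun key z
  simpa [h r] using this

end LinearAlgebra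

namespace Rep

variable {k G : Type u} [Field k] [Group G]

section Average

variable [Fintype G]

/-- The equivariant map obtained from a linear map by averaging over the group. -/
def average (A B : Rep.{u} k G) : (A.V →ₗ[k] B.V) →ₗ[k] (A ⟶ B) where
  toFun φ := Rep.ofHom (LinearMap.intertwiningMap_of_isIntertwiningMap A.ρ B.ρ
    ((Fintype.card G : k)⁻¹ • ∑ g : G, B.ρ g ∘ₗ φ ∘ₗ A.ρ g⁻¹) fun h v ↦ by
      simp only [LinearMap.smul_apply, LinearMap.sum_apply, LinearMap.comp_apply, map_smul,
        map_sum]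
      congr 1
      refine Fintype.sum_equiv (Equiv.mulLeft h⁻¹) _ _ fun g ↦ ?_
      simp [← Module.End.mul_apply, ← map_mul])
  map_add' φ ψ := by
    ext v
    rw [add_hom]
    simp [Finset.sum_add_distrib]
  map_smul' c φ := by
    ext v
    rw [smul_hom]
    simp [Finset.smul_sum, smul_comm c]

theorem average_hom_apply {A B : Rep.{u} k G} (φ : A.V →ₗ[k] B.V) (v : A.V) :
    (average A B φ).hom v = (Fintype.card G : k)⁻¹ • ∑ g : G, B.ρ g (φ (A.ρ g⁻¹ v)) := by
  simp [average]

theorem average_comp_left {A B C : Rep.{u} k G} (φ : A.V →ₗ[k] B.V) (f : B ⟶ C) :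
    average A C (f.hom.toLinearMap ∘ₗ φ) = average A B φ ≫ f := by
  ext v
  simp [average_hom_apply, hom_comm_apply]

theorem average_comp_right {A B C : Rep.{u} k G} (f : A ⟶ B) (φ : B.V →ₗ[k] C.V) :
    average A C (φ ∘ₗ f.hom.toLinearMap) = f ≫ average B C φ := by
  ext v
  simp [average_hom_apply, hom_comm_apply]

theorem average_hom (hchar : (Fintype.card G : k) ≠ 0) {A B : Rep.{u} k G} (f : A ⟶ B) :
    average A B f.hom.toLinearMap = f := by
  ext v
  simp [average_hom_apply, ← hom_comm_apply, ← Module.End.mul_apply, ← map_mul,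
    ← Nat.cast_smul_eq_nsmul k, smul_smul, hchar]

/-- Maschke's theorem: monomorphisms of representations split. -/
theorem exists_retraction (hchar : (Fintype.card G : k) ≠ 0) {A B : Rep.{u} k G} (f : A ⟶ B)
    [Mono f] : ∃ r : B ⟶ A, f ≫ r = 𝟙 A := by
  obtain ⟨s, hs⟩ := LinearMap.exists_leftInverse_of_injective f.hom.toLinearMap
    (LinearMap.ker_eq_bot.2 ((mono_iff_injective f).1 inferInstance))
  refine ⟨average B A s, ?_⟩
  rw [← average_comp_right, hs]
  exact average_hom hchar (𝟙 A)

end Average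

section Simple

theorem finiteDimensional_of_simple [Finite G] (A : Rep.{u} k G) [Simple A] :
    FiniteDimensional k A.V := by
  have hA : ¬ Subsingleton A.V := fun h ↦ Simple.not_isZero A ((isZero_iff _ _ A).2 h)
  rw [not_subsingleton_iff_nontrivial] at hA
  obtain ⟨x, hx⟩ := exists_ne (0 : A.V)
  have hf : leftRegularHom A x ≠ 0 := by
    intro h
    apply hx
    simpa [h] using (leftRegularHom_hom_single (1 : G) x 1).symm
  have : Epi (leftRegularHom A x) := epi_of_nonzero_to_simple hf
  have hsurj := (epi_iff_surjective _).1 this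
  have : Module.Finite k (leftRegular k G).V :=
    Module.Finite.equiv (MonoidAlgebra.coeffLinearEquiv k).symm
  exact Module.Finite.of_surjective (leftRegularHom A x).hom.toLinearMap hsurj

instance finiteDimensional_hom (A B : Rep.{u} k G) [FiniteDimensional k A.V]
    [FiniteDimensional k B.V] : FiniteDimensional k (A ⟶ B) :=
  Module.Finite.of_injective
    (⟨⟨fun f ↦ f.hom.toLinearMap, fun _ _ ↦ rfl⟩, fun _ _ ↦ rfl⟩ : (A ⟶ B) →ₗ[k] A.V →ₗ[k] B.V)
    fun _ _ h ↦ hom_ext (Representation.IntertwiningMap.ext h)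

theorem exists_endomorphism_scalar [IsAlgClosed k] [Finite G] (A : Rep.{u} k G) [Simple A] :
    ∃ e : (A ⟶ A) →ₗ[k] k, ∀ f, e f • 𝟙 A = f := by
  have := finiteDimensional_of_simple A
  have hbij : Function.Bijective (LinearMap.toSpanSingleton k (A ⟶ A) (𝟙 A)) :=
    ⟨smul_left_injective k (id_nonzero A), fun f ↦ endomorphism_simple_eq_smul_id k f⟩
  exact ⟨(LinearEquiv.ofBijective _ hbij).symm.toLinearMap,
    fun f ↦ (LinearEquiv.ofBijective _ hbij).apply_symm_apply f⟩

/-- Every representation is spanned by the images of the morphisms out of simple ones. -/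
theorem span_images_eq_top [Fintype G] (hchar : (Fintype.card G : k) ≠ 0) {ι : Type*}
    (L : ι → Rep.{u} k G) (hcomplete : ∀ X : Rep.{u} k G, Simple X → ∃ i, Nonempty (X ≅ L i))
    (X : Rep.{u} k G) :
    Submodule.span k {x : X.V | ∃ (t : ι) (f : L t ⟶ X) (l : (L t).V), f.hom l = x} = ⊤ := by
  have : NeZero (Nat.card G : k) := ⟨by rwa [Nat.card_eq_fintype_card]⟩
  set s := {x : X.V | ∃ (t : ι) (f : L t ⟶ X) (l : (L t).V), f.hom l = x} with hs
  let W : Subrepresentation X.ρ :=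
    { toSubmodule := Submodule.span k s
      apply_mem_toSubmodule := fun g v hv ↦ by
        have : Submodule.span k s ≤ (Submodule.span k s).comap (X.ρ g) := by
          rw [Submodule.span_le]
          rintro _ ⟨t, f, l, rfl⟩
          exact Submodule.subset_span ⟨t, f, (L t).ρ g l, hom_comm_apply f g l⟩
        exact this hv }
  have : IsSemisimpleModule (MonoidAlgebra k G) X.ρ.asModule :=
    (Representation.isSemisimpleRepresentation_iff_isSemisimpleModule_asModule X.ρ).1
      inferInstance
  have hW : W.asSubmodule = ⊤ := by
    rw [eq_top_iff, ← IsSemisimpleModule.sSup_simples_eq_top (MonoidAlgebra k G) X.ρ.asModule]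
    refine sSup_le fun S (hS : IsSimpleModule _ S) x hx ↦ ?_
    let F : ModuleCat (MonoidAlgebra k G) ⥤ Rep.{u} k G := equivalenceModuleMonoidAlgebra.inverse
    have : Simple (F.obj (ModuleCat.of _ S)) := simple_obj F _
    obtain ⟨t, ⟨e⟩⟩ := hcomplete _ this
    let f : F.obj (ModuleCat.of _ S) ⟶ X :=
      F.map (Y := ModuleCat.of _ X.ρ.asModule) (ModuleCat.ofHom S.subtype) ≫
        (equivalenceModuleMonoidAlgebra.unitIso.app X).inv
    change X.ρ.asModuleEquiv x ∈ Submodule.span k s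
    let y : F.obj (ModuleCat.of _ S) := (⟨x, hx⟩ : S)
    have hy : f.hom y = X.ρ.asModuleEquiv x := rfl
    refine Submodule.subset_span ⟨t, e.inv ≫ f, e.hom.hom y, ?_⟩
    rw [← hy, ← comp_apply, Iso.hom_inv_id_assoc]
  rw [eq_top_iff]
  intro x _
  have : X.ρ.asModuleEquiv.symm x ∈ W.asSubmodule := hW ▸ Submodule.mem_top
  exact this

end Simple

/-- The map `Hom(B, X) ⊗ Hom(A, B ⊗ N) → Hom(A, X ⊗ N)`, `f ⊗ g ↦ (f ⊗ id_N) ∘ g`. -/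
def whiskerComp (A B X N : Rep.{u} k G) :
    TensorProduct k (B ⟶ X) (A ⟶ B ⊗ N) →ₗ[k] (A ⟶ X ⊗ N) :=
  TensorProduct.lift (LinearMap.mk₂ k (fun f g ↦ g ≫ f ▷ N)
    (fun _ _ _ ↦ by simp) (fun _ _ _ ↦ by simp) (fun _ _ _ ↦ by simp) (fun _ _ _ ↦ by simp))

@[simp]
theorem whiskerComp_tmul {A B X N : Rep.{u} k G} (f : B ⟶ X) (g : A ⟶ B ⊗ N) :
    whiskerComp A B X N (f ⊗ₜ g) = g ≫ f ▷ N := rfl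

variable {ι : Type*} [DecidableEq ι]

/-- The sum of the maps `whiskerComp A (L t) X N`. -/
def sumWhiskerComp (L : ι → Rep.{u} k G) (A X N : Rep.{u} k G) :
    (⨁ t, TensorProduct k (L t ⟶ X) (A ⟶ L t ⊗ N)) →ₗ[k] (A ⟶ X ⊗ N) :=
  DirectSum.toModule k ι _ fun t ↦ whiskerComp A (L t) X N

theorem sumWhiskerComp_lof (L : ι → Rep.{u} k G) (A X N : Rep.{u} k G) (t : ι) (f : L t ⟶ X)
    (g : A ⟶ L t ⊗ N) :
    sumWhiskerComp L A X N (DirectSum.lof k ι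
      (fun t ↦ TensorProduct k (L t ⟶ X) (A ⟶ L t ⊗ N)) t (f ⊗ₜ[k] g)) = g ≫ f ▷ N := by
  simp [sumWhiskerComp]

theorem sumWhiskerComp_injective [IsAlgClosed k] [Fintype G]
    (hchar : (Fintype.card G : k) ≠ 0) (L : ι → Rep.{u} k G) (hsimple : ∀ i, Simple (L i))
    (hdistinct : ∀ i j, i ≠ j → IsEmpty (L i ≅ L j)) (A X N : Rep.{u} k G) :
    Function.Injective (sumWhiskerComp L A X N) := by
  rw [injective_iff_map_eq_zero]
  intro z hz
  refine DFinsupp.ext fun t ↦ ?_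
  obtain ⟨e, he⟩ := exists_endomorphism_scalar (L t)
  let φ (r : X ⟶ L t) : (L t ⟶ X) →ₗ[k] k := e ∘ₗ Linear.rightComp k (L t) r
  refine TensorProduct.eq_zero_of_separating φ (fun f hf ↦ ?_) _ fun r ↦ ?_
  · by_contra hne
    have := mono_of_nonzero_from_simple hne
    obtain ⟨r, hr⟩ := exists_retraction hchar f
    refine id_nonzero (L t) ?_
    rw [← he (𝟙 (L t)), ← hr]
    simpa [φ] using congrArg (· • (f ≫ r)) (hf r)
  · have key : Linear.rightComp k A (r ▷ N) ∘ₗ sumWhiskerComp L A X N =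
        (TensorProduct.lid k _).toLinearMap ∘ₗ (φ r).rTensor _ ∘ₗ
          DirectSum.component k ι (fun t ↦ TensorProduct k (L t ⟶ X) (A ⟶ L t ⊗ N)) t := by
      refine DirectSum.linearMap_ext k fun s ↦ TensorProduct.ext' fun f g ↦ ?_
      simp only [LinearMap.comp_apply, sumWhiskerComp_lof, Linear.rightComp_apply,
        Category.assoc, ← comp_whiskerRight]
      rcases eq_or_ne s t with rfl | hst
      · rw [DirectSum.component.lof_self, ← he (f ≫ r)]
        simp [φ]
      · have hfr : f ≫ r = 0 := by
          by_contra hne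
          have := isIso_of_hom_simple hne
          exact (hdistinct s t hst).false (asIso (f ≫ r))
        rw [DirectSum.component.of, dif_neg hst, hfr]
        simp
    have := LinearMap.congr_fun key z
    rw [LinearMap.comp_apply, hz, map_zero] at this
    exact this.symm

theorem sumWhiskerComp_surjective [Fintype G] (hchar : (Fintype.card G : k) ≠ 0)
    (L : ι → Rep.{u} k G) (hcomplete : ∀ X : Rep.{u} k G, Simple X → ∃ i, Nonempty (X ≅ L i))
    (A X N : Rep.{u} k G) [FiniteDimensional k A.V] :
    Function.Surjective (sumWhiskerComp L A X N) := by
  have hmem (c : A.V →ₗ[k] k) (y : (X ⊗ N).V) :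
      average A (X ⊗ N) (c.smulRight y) ∈ LinearMap.range (sumWhiskerComp L A X N) := by
    let P : (X ⊗ N).V →ₗ[k] (A ⟶ X ⊗ N) := average A (X ⊗ N) ∘ₗ LinearMap.smulRightₗ c
    change P y ∈ _
    induction y using TensorProduct.induction_on with
    | zero => rw [map_zero]; exact zero_mem _
    | add y₁ y₂ h₁ h₂ => rw [map_add]; exact add_mem h₁ h₂
    | tmul x n =>
      have hx : x ∈ Submodule.span k
          {x : X.V | ∃ (t : ι) (f : L t ⟶ X) (l : (L t).V), f.hom l = x} := by
        rw [span_images_eq_top hchar L hcomplete X]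
        trivial
      induction hx using Submodule.span_induction with
      | zero => rw [TensorProduct.zero_tmul, map_zero]; exact zero_mem _
      | add x₁ x₂ _ _ h₁ h₂ => rw [TensorProduct.add_tmul, map_add]; exact add_mem h₁ h₂
      | smul a x _ h =>
        have : P ((a • x) ⊗ₜ[k] n) = a • P (x ⊗ₜ[k] n) := P.map_smul a (x ⊗ₜ[k] n)
        rw [this]
        exact Submodule.smul_mem _ a h
      | mem x h =>
        obtain ⟨t, f, l, rfl⟩ := h
        refine ⟨_, (sumWhiskerComp_lof L A X N t f
          (average A (L t ⊗ N) (c.smulRight (l ⊗ₜ[k] n)))).trans ?_⟩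
        rw [← average_comp_left]
        refine congrArg (average A (X ⊗ N)) (LinearMap.ext fun a ↦ ?_)
        simp
  intro h
  change h ∈ LinearMap.range (sumWhiskerComp L A X N)
  let b := Module.finBasis k A.V
  have hsum : h.hom.toLinearMap = ∑ i, (b.coord i).smulRight (h.hom (b i)) := by
    refine b.ext fun i ↦ ?_
    simp [Finsupp.single_apply]
  rw [← average_hom hchar h, hsum, map_sum]
  exact sum_mem fun i _ ↦ hmem _ _

end Rep

end

/-- componentwise monoidality of `F = Hom_{kG}(L, L ⊗ −)`: the map
`⊕_t Hom(L_t, L_j ⊗ M) ⊗ Hom(L_i, L_t ⊗ N) → Hom(L_i, L_j ⊗ M ⊗ N)`,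
`f ⊗ g ↦ (f ⊗ id_N) ∘ g`, is a `k`-linear isomorphism. -/
theorem hom_tensor_monoidal (k G : Type u) [Field k] [IsAlgClosed k] [Group G] [Fintype G]
    (hchar : (Fintype.card G : k) ≠ 0)
    (m : ℕ) (L : Fin (m + 1) → Rep k G)
    (hsimple : ∀ i, Simple (L i))
    (hdistinct : ∀ i j, i ≠ j → IsEmpty (L i ≅ L j))
    (hcomplete : ∀ X : Rep k G, Simple X → ∃ i, Nonempty (X ≅ L i))
    (htriv : Nonempty (L 0 ≅ Rep.trivial k G k))
    (i j : Fin (m + 1)) (M N : Rep k G) :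
    ∃ e : (⨁ t : Fin (m + 1), TensorProduct k (L t ⟶ L j ⊗ M) (L i ⟶ L t ⊗ N)) ≃ₗ[k]
        (L i ⟶ (L j ⊗ M) ⊗ N),
      ∀ (t : Fin (m + 1)) (f : L t ⟶ L j ⊗ M) (g : L i ⟶ L t ⊗ N),
        e (DirectSum.lof k (Fin (m + 1))
            (fun t => TensorProduct k (L t ⟶ L j ⊗ M) (L i ⟶ L t ⊗ N)) t (f ⊗ₜ[k] g)) =
          g ≫ (f ▷ N) := by
  have := hsimple i
  have := Rep.finiteDimensional_of_simple (L i)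
  exact ⟨LinearEquiv.ofBijective (Rep.sumWhiskerComp L (L i) (L j ⊗ M) N)
    ⟨Rep.sumWhiskerComp_injective hchar L hsimple hdistinct _ _ _,
      Rep.sumWhiskerComp_surjective hchar L hcomplete _ _ _⟩,
    fun t f g ↦ Rep.sumWhiskerComp_lof L (L i) (L j ⊗ M) N t f g⟩
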